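/- Define g : ℝ² → ℝ by g(x,y) = (1 − e^{−π²(x²+y²)})/(x²+y²) for (x,y) ≠ (0,0) and g(0,0) = π². Then for each parity p ∈ {0,1}, lim_{t→0⁺} sup_{x∈ℝ} | 2√t · Σ_{v∈ℤ, v ≡ p (mod 2)} g(x, v√t)² − ∫_ℝ g(x,y)² dy | = 0; that is, the Riemann sums 2√t Σ_{v ≡ p (2)} g(x, v√t)² converge to ∫_ℝ g(x,y)² dy as t → 0, uniformly in x ∈ ℝ. -/

import Mathlib

open Real Filter

/-- The function `g(x,y) = (1 − e^{−π²(x²+y²)})/(x²+y²)` for `(x,y) ≠ (0,0)`,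
with `g(0,0) = π²`. -/
noncomputable def gFun (x y : ℝ) : ℝ :=
  if (x, y) = (0, 0) then π ^ 2
  else (1 - Real.exp (-π ^ 2 * (x ^ 2 + y ^ 2))) / (x ^ 2 + y ^ 2)

lemma gFun_nonneg (x y : ℝ) : 0 ≤ gFun x y := by
  unfold gFun
  split_ifs
  · positivity
  · have : Real.exp (-π ^ 2 * (x ^ 2 + y ^ 2)) ≤ 1 :=
      Real.exp_le_one_iff.2 (by nlinarith [mul_nonneg (sq_nonneg π) (by positivity : 0 ≤ x ^ 2 + y ^ 2)])
    exact div_nonneg (by linarith) (by positivity)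

lemma gFun_mul_le_one (x y : ℝ) : gFun x y * (x ^ 2 + y ^ 2) ≤ 1 := by
  unfold gFun
  split_ifs with h
  · obtain ⟨rfl, rfl⟩ := Prod.mk.inj h
    norm_num
  · rcases (by positivity : 0 ≤ x ^ 2 + y ^ 2).eq_or_lt with h0 | h0
    · rw [← h0]
      norm_num
    · rw [div_mul_cancel₀ _ h0.ne']
      linarith [Real.exp_pos (-π ^ 2 * (x ^ 2 + y ^ 2))]

lemma sq_add_sq_pos_of_ne {x y : ℝ} (h : (x, y) ≠ (0, 0)) : 0 < x ^ 2 + y ^ 2 := by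
  by_cases hx : x = 0
  · have hy : y ≠ 0 := fun hy => h (by rw [hx, hy])
    positivity
  · positivity

lemma gFun_le (x y : ℝ) : gFun x y ≤ π ^ 2 := by
  unfold gFun
  split_ifs with h
  · exact le_rfl
  · rw [div_le_iff₀ (sq_add_sq_pos_of_ne h)]
    linarith [Real.add_one_le_exp (-π ^ 2 * (x ^ 2 + y ^ 2))]

lemma one_sub_exp_neg_div_le {a r s : ℝ} (hr : 0 < r) (hrs : r ≤ s) :
    (1 - Real.exp (-a * s)) / s ≤ (1 - Real.exp (-a * r)) / r := by
  have hs : 0 < s := hr.trans_le hrs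
  have hconv := convexOn_exp.2 (Set.mem_univ 0) (Set.mem_univ (-a * s))
    (sub_nonneg.2 ((div_le_one hs).2 hrs)) (by positivity : 0 ≤ r / s) (by ring)
  have harg : (1 - r / s) • (0 : ℝ) + (r / s) • (-a * s) = -a * r := by
    simp only [smul_eq_mul]
    field_simp
    ring
  rw [harg, Real.exp_zero, smul_eq_mul, smul_eq_mul] at hconv
  rw [le_div_iff₀ hr]
  calc (1 - Real.exp (-a * s)) / s * r = r / s - r / s * Real.exp (-a * s) := by ring
    _ ≤ 1 - Real.exp (-a * r) := by linarith

lemma gFun_antitoneOn (x : ℝ) : AntitoneOn (gFun x) (Set.Ici 0) := by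
  intro y hy z hz hyz
  rw [Set.mem_Ici] at hy hz
  by_cases h : (x, y) = (0, 0)
  · rw [show gFun x y = π ^ 2 from if_pos h]
    exact gFun_le x z
  · have hpos := sq_add_sq_pos_of_ne h
    have hle : x ^ 2 + y ^ 2 ≤ x ^ 2 + z ^ 2 := by gcongr
    have h' : (x, z) ≠ (0, 0) := by
      intro h'
      obtain ⟨rfl, rfl⟩ := Prod.mk.inj h'
      nlinarith
    unfold gFun
    rw [if_neg h, if_neg h']
    exact one_sub_exp_neg_div_le hpos hle

lemma gFun_sq_antitoneOn (x : ℝ) : AntitoneOn (fun y => gFun x y ^ 2) (Set.Ici 0) :=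
  fun _ hy z hz hyz => pow_le_pow_left₀ (gFun_nonneg x z) (gFun_antitoneOn x hy hz hyz) 2

lemma gFun_abs (x y : ℝ) : gFun x |y| = gFun x y := by
  simp [gFun]

lemma gFun_neg (x y : ℝ) : gFun x (-y) = gFun x y := by
  rw [← gFun_abs, abs_neg, gFun_abs]

lemma measurable_gFun (x : ℝ) : Measurable (gFun x) := by
  unfold gFun
  refine Measurable.ite ?_ measurable_const (by fun_prop)
  exact (measurableSet_singleton ((0 : ℝ), (0 : ℝ))).preimage measurable_prodMk_left

lemma integrable_gFun_sq (x : ℝ) : MeasureTheory.Integrable (fun y => gFun x y ^ 2) := by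
  refine (integrable_inv_one_add_sq.const_mul (π ^ 2 * (π ^ 2 + 1))).mono'
    ((measurable_gFun x).pow_const 2).aestronglyMeasurable (Eventually.of_forall fun y => ?_)
  have h0 := gFun_nonneg x y
  have h1 := gFun_le x y
  have h2 := gFun_mul_le_one x y
  rw [Real.norm_of_nonneg (sq_nonneg _), ← div_eq_mul_inv, le_div_iff₀ (by positivity)]
  have h3 : gFun x y * (1 + y ^ 2) ≤ π ^ 2 + 1 := by
    nlinarith [mul_nonneg h0 (sq_nonneg x)]
  calc gFun x y ^ 2 * (1 + y ^ 2) = gFun x y * (gFun x y * (1 + y ^ 2)) := by ring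
    _ ≤ π ^ 2 * (π ^ 2 + 1) := by gcongr

section HalfLine

open MeasureTheory

variable {f : ℝ → ℝ} {c : ℝ}

lemma sum_range_le_add_integral_Ioi (hf : AntitoneOn f (Set.Ici 0)) (hf0 : ∀ y, 0 ≤ f y)
    (hfi : IntegrableOn f (Set.Ioi 0)) (hc0 : 0 ≤ c) (n : ℕ) :
    ∑ i ∈ Finset.range n, f (c + i) ≤ f 0 + ∫ y in Set.Ioi 0, f y := by
  calc ∑ i ∈ Finset.range n, f (c + i) ≤ ∑ i ∈ Finset.range (n + 1), f (c + i) :=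
        Finset.sum_le_sum_of_subset_of_nonneg (Finset.range_mono n.le_succ) fun _ _ _ => hf0 _
    _ = f c + ∑ i ∈ Finset.range n, f (c + (i + 1 : ℕ)) := by
        rw [Finset.sum_range_succ', Nat.cast_zero, add_zero, add_comm]
    _ ≤ f 0 + ∫ y in c..c + n, f y := by
        gcongr
        · exact hf Set.self_mem_Ici hc0 hc0
        · exact (hf.mono fun y hy => hc0.trans hy.1).sum_le_integral
    _ ≤ f 0 + ∫ y in Set.Ioi 0, f y := by
        rw [intervalIntegral.integral_of_le (by simp)]
        gcongr
        · exact Eventually.of_forall hf0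
        · exact fun y hy => hc0.trans_lt hy.1

/-- Comparison of a unit-step Riemann sum with the integral for an antitone function on the
half-line. -/
lemma summable_and_abs_tsum_sub_integral_Ioi_le (hf : AntitoneOn f (Set.Ici 0))
    (hf0 : ∀ y, 0 ≤ f y) (hfi : IntegrableOn f (Set.Ioi 0)) (hc0 : 0 ≤ c) (hc1 : c ≤ 1) :
    Summable (fun n : ℕ => f (c + n)) ∧
      |∑' n : ℕ, f (c + n) - ∫ y in Set.Ioi 0, f y| ≤ f 0 := by
  have hbound := sum_range_le_add_integral_Ioi hf hf0 hfi hc0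
  have hsum : Summable (fun n : ℕ => f (c + n)) :=
    summable_of_sum_range_le (fun _ => hf0 _) hbound
  refine ⟨hsum, abs_sub_le_iff.2 ⟨?_, ?_⟩⟩
  · linarith [Real.tsum_le_of_sum_range_le (fun _ => hf0 _) hbound]
  · have hfc : IntegrableOn f (Set.Ioi c) := hfi.mono_set (Set.Ioi_subset_Ioi hc0)
    have htail : ∫ y in Set.Ioi c, f y ≤ ∑' n : ℕ, f (c + n) := by
      refine le_of_tendsto_of_tendsto (intervalIntegral_tendsto_integral_Ioi c hfc
        (tendsto_atTop_add_const_left _ c tendsto_natCast_atTop_atTop))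
        hsum.hasSum.tendsto_sum_nat (Eventually.of_forall fun n => ?_)
      exact (hf.mono fun y hy => hc0.trans hy.1).integral_le_sum
    have hhead : ∫ y in (0 : ℝ)..c, f y ≤ f 0 := by
      have hfI : IntervalIntegrable f volume 0 c :=
        (intervalIntegrable_iff_integrableOn_Ioc_of_le hc0).2
          (hfi.mono_set Set.Ioc_subset_Ioi_self)
      calc ∫ y in (0 : ℝ)..c, f y ≤ ∫ _ in (0 : ℝ)..c, f 0 :=
            intervalIntegral.integral_mono_on hc0 hfI intervalIntegrable_const
              fun y hy => hf Set.self_mem_Ici hy.1 hy.1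
        _ = c * f 0 := by simp
        _ ≤ f 0 := mul_le_of_le_one_left (hf0 0) hc1
    have hsplit := intervalIntegral.integral_interval_add_Ioi hfi hfc
    linarith

/-- Comparison of a Riemann sum with step `δ` with the integral for an antitone function on the
half-line. -/
lemma summable_and_abs_mul_tsum_sub_integral_Ioi_le {δ : ℝ} (hδ : 0 < δ)
    (hf : AntitoneOn f (Set.Ici 0)) (hf0 : ∀ y, 0 ≤ f y) (hfi : IntegrableOn f (Set.Ioi 0))
    (hc0 : 0 ≤ c) (hc1 : c ≤ 1) :
    Summable (fun n : ℕ => f (δ * (c + n))) ∧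
      |δ * ∑' n : ℕ, f (δ * (c + n)) - ∫ y in Set.Ioi 0, f y| ≤ δ * f 0 := by
  have hanti : AntitoneOn (fun y => f (δ * y)) (Set.Ici 0) := fun y hy z hz hyz =>
    hf (mul_nonneg hδ.le hy) (mul_nonneg hδ.le hz) (by gcongr)
  have hint : IntegrableOn (fun y => f (δ * y)) (Set.Ioi 0) :=
    (integrableOn_Ioi_comp_mul_left_iff f 0 hδ).2 (by rwa [mul_zero])
  obtain ⟨hsum, hle⟩ :=
    summable_and_abs_tsum_sub_integral_Ioi_le hanti (fun _ => hf0 _) hint hc0 hc1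
  refine ⟨hsum, ?_⟩
  rw [integral_comp_mul_left_Ioi f 0 hδ, mul_zero, smul_eq_mul] at hle
  calc |δ * ∑' n : ℕ, f (δ * (c + n)) - ∫ y in Set.Ioi 0, f y|
      = |δ * (∑' n : ℕ, f (δ * (c + n)) - δ⁻¹ * ∫ y in Set.Ioi 0, f y)| := by
        rw [mul_sub, mul_inv_cancel_left₀ hδ.ne']
    _ = δ * |∑' n : ℕ, f (δ * (c + n)) - δ⁻¹ * ∫ y in Set.Ioi 0, f y| := by
        rw [abs_mul, abs_of_pos hδ]
    _ ≤ δ * f 0 := by gcongr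

/-- Comparison of a shifted Riemann sum with step `δ` with the integral for an even function
that is antitone on the half-line. -/
lemma abs_mul_tsum_int_sub_integral_le {δ : ℝ} (hδ : 0 < δ)
    (hf : AntitoneOn f (Set.Ici 0)) (hf0 : ∀ y, 0 ≤ f y) (hfi : IntegrableOn f (Set.Ioi 0))
    (heven : ∀ y, f (-y) = f y) (hc0 : 0 ≤ c) (hc1 : c ≤ 1) :
    |δ * ∑' k : ℤ, f (δ * (c + k)) - ∫ y, f y| ≤ 2 * (δ * f 0) := by
  obtain ⟨hs₁, hle₁⟩ :=
    summable_and_abs_mul_tsum_sub_integral_Ioi_le hδ hf hf0 hfi hc0 hc1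
  obtain ⟨hs₂, hle₂⟩ := summable_and_abs_mul_tsum_sub_integral_Ioi_le hδ hf hf0 hfi
    (sub_nonneg.2 hc1) (sub_le_self 1 hc0)
  have hneg (n : ℕ) : f (δ * (c + (-(n + 1 : ℤ) : ℤ))) = f (δ * (1 - c + n)) := by
    rw [← heven]
    congr 1
    push_cast
    ring
  have htsum : ∑' k : ℤ, f (δ * (c + k)) =
      ∑' n : ℕ, f (δ * (c + n)) + ∑' n : ℕ, f (δ * (1 - c + n)) := by
    refine (HasSum.of_nat_of_neg_add_one ?_ ?_).tsum_eq
    · simpa only [Int.cast_natCast] using hs₁.hasSum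
    · simpa only [hneg] using hs₂.hasSum
  have hint : ∫ y, f y = 2 * ∫ y in Set.Ioi 0, f y := by
    rw [← integral_comp_abs]
    congr 1 with y
    rcases abs_choice y with h | h <;> rw [h]
    rw [heven]
  rw [htsum, hint]
  rw [abs_le] at *
  constructor <;> linarith

end HalfLine

/-- The integers of residue `p` modulo `n`, parametrised by their quotient by `n`. -/
def intEquivResidue (n p : ℤ) (hn : 0 < n) (hp0 : 0 ≤ p) (hpn : p < n) :
    ℤ ≃ {v : ℤ // v % n = p} where
  toFun k := ⟨p + n * k, by rw [Int.add_mul_emod_self_left, Int.emod_eq_of_lt hp0 hpn]⟩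
  invFun v := v / n
  left_inv k := by
    simp [Int.add_mul_ediv_left _ _ hn.ne', Int.ediv_eq_zero_of_lt hp0 hpn]
  right_inv v := Subtype.ext <| by
    have h := Int.emod_add_mul_ediv (v : ℤ) n
    rwa [v.2] at h

lemma abs_riemann_sum_gFun_sub_integral_le {p : ℤ} (hp : p = 0 ∨ p = 1) {t : ℝ} (ht : 0 < t)
    (x : ℝ) :
    |2 * √t * ∑' v : {v : ℤ // v % 2 = p}, gFun x ((v : ℤ) * √t) ^ 2 - ∫ y, gFun x y ^ 2| ≤
      4 * π ^ 4 * √t := by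
  have hp0 : 0 ≤ p := by lia
  have hp1 : p ≤ 1 := by lia
  have hp0' : (0 : ℝ) ≤ p := mod_cast hp0
  have hp1' : (p : ℝ) ≤ 1 := mod_cast hp1
  have hsum : ∑' v : {v : ℤ // v % 2 = p}, gFun x ((v : ℤ) * √t) ^ 2 =
      ∑' k : ℤ, gFun x (2 * √t * (p / 2 + k)) ^ 2 := by
    rw [← (intEquivResidue 2 p two_pos hp0 (by lia)).tsum_eq]
    congr 1 with k
    congr 2
    simp only [intEquivResidue, Equiv.coe_fn_mk]
    push_cast
    ring
  rw [hsum]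
  refine (abs_mul_tsum_int_sub_integral_le (f := fun y => gFun x y ^ 2) (c := p / 2)
    (by positivity) (gFun_sq_antitoneOn x) (fun _ => sq_nonneg _)
    (integrable_gFun_sq x).integrableOn (fun y => by rw [gFun_neg]) (by positivity)
    (by linarith)).trans ?_
  have hsq : gFun x 0 ^ 2 ≤ (π ^ 2) ^ 2 := pow_le_pow_left₀ (gFun_nonneg x 0) (gFun_le x 0) 2
  calc 2 * (2 * √t * gFun x 0 ^ 2) ≤ 2 * (2 * √t * (π ^ 2) ^ 2) := by gcongr
    _ = 4 * π ^ 4 * √t := by ring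

/-- For each parity `p ∈ {0,1}`, the Riemann sums
`2√t · Σ_{v ∈ ℤ, v ≡ p (mod 2)} g(x, v√t)²` converge, as `t → 0⁺`, to
`∫_ℝ g(x,y)² dy`, uniformly in `x ∈ ℝ`. -/
theorem riemann_sum_uniform_convergence (p : ℤ) (hp : p = 0 ∨ p = 1) :
    TendstoUniformly
      (fun (t : ℝ) (x : ℝ) =>
        2 * Real.sqrt t *
          ∑' v : {v : ℤ // v % 2 = p}, gFun x ((v : ℤ) * Real.sqrt t) ^ 2)
      (fun x : ℝ => ∫ y : ℝ, gFun x y ^ 2)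
      (nhdsWithin 0 (Set.Ioi 0)) := by
  rw [Metric.tendstoUniformly_iff]
  intro ε hε
  have hlim : Tendsto (fun t : ℝ => 4 * π ^ 4 * √t) (nhdsWithin 0 (Set.Ioi 0)) (nhds 0) := by
    have hcont : Continuous fun t : ℝ => 4 * π ^ 4 * √t := by fun_prop
    simpa using (hcont.tendsto 0).mono_left nhdsWithin_le_nhds
  filter_upwards [hlim.eventually_lt_const hε, self_mem_nhdsWithin] with t htε ht x
  rw [dist_comm, Real.dist_eq]
  exact (abs_riemann_sum_gFun_sub_integral_le hp ht x).trans_lt htε
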